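/- Let S be a measurable space, P a Markov (probability) kernel from S to S, ρ a probability measure on S, and define the state distributions by μ_0 = ρ and μ_{t+1} = μ_t.bind P. Let ν be a σ-finite measure on S such that every μ_t has a density p_t with respect to ν, the densities p_t converge ν-almost everywhere pointwise to a function q which is the density of a probability measure q_π = q·ν, and there is a constant M > 0 with p_t(s) ≤ M for all t and ν-almost every s. Let c : S → [0,∞) be measurable and ν-integrable, and let L : S → [0,∞) be measurable with α₁·c(s) ≤ L(s) ≤ α₂·c(s) for all s, for some positive constants α₁, α₂. Assume ∫ L dρ < ∞ and that the energy-decreasing condition holds: ∫_S ( ∫_S L(s') P(s, ds') − L(s) ) dq_π(s) ≤ −α₃ · ∫_S c dq_π for some positive constant α₃. Then lim_{t→∞} ∫_S c dμ_t = 0. -/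

import Mathlib

open MeasureTheory ProbabilityTheory Filter
open scoped ENNReal NNReal

lemma stab_aux {S : Type*} [MeasurableSpace S] (P : Kernel S S) [IsMarkovKernel P]
    (m : Measure S) [IsProbabilityMeasure m] (L : S → ℝ) (h : Integrable L (m.bind P)) :
    Integrable (fun s => ∫ s', L s' ∂(P s)) m ∧
      ∫ s, (∫ s', L s' ∂(P s)) ∂m = ∫ s, L s ∂(m.bind P) := by
  have e : (P ∘ₖ Kernel.const Unit m) () = m.bind P := by
    rw [Kernel.comp_apply, Kernel.const_apply]
  rw [← e] at h ⊢
  have h1 := MeasureTheory.Integrable.integral_comp h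
  have h2 := ProbabilityTheory.Kernel.integral_comp h
  rw [Kernel.const_apply] at h1 h2
  exact ⟨h1, h2.symm⟩

/-- Data-based stability theorem (Theorem 1 of the paper): if the state distributions
`μ t` of the closed-loop Markov chain have uniformly bounded densities `p t` w.r.t. a
σ-finite measure `ν` converging `ν`-a.e. to the density `q` of a stationary probability
measure `q_π = q·ν`, and there is a Lyapunov function `L` comparable to the cost `c`
satisfying the energy-decreasing condition w.r.t. `q_π`, then the expected cost
`∫ c ∂(μ t)` tends to `0`. -/
theorem stability_in_mean_cost
    {S : Type*} [MeasurableSpace S]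
    (P : Kernel S S) [IsMarkovKernel P]
    (ρ : Measure S) [IsProbabilityMeasure ρ]
    (μ : ℕ → Measure S) (hμ0 : μ 0 = ρ) (hμ : ∀ t, μ (t + 1) = (μ t).bind P)
    (ν : Measure S) [SigmaFinite ν]
    (p : ℕ → S → ℝ≥0∞) (hpmeas : ∀ t, Measurable (p t))
    (hdens : ∀ t, μ t = ν.withDensity (p t))
    (q : S → ℝ≥0∞) (hqmeas : Measurable q)
    (hconv : ∀ᵐ s ∂ν, Tendsto (fun t => p t s) atTop (nhds (q s)))
    (hqprob : IsProbabilityMeasure (ν.withDensity q))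
    (M : ℝ≥0) (hM : 0 < M) (hbound : ∀ t, ∀ᵐ s ∂ν, p t s ≤ (M : ℝ≥0∞))
    (c : S → ℝ) (hcmeas : Measurable c) (hcnonneg : ∀ s, 0 ≤ c s)
    (hcint : Integrable c ν)
    (L : S → ℝ) (hLmeas : Measurable L) (hLnonneg : ∀ s, 0 ≤ L s)
    (α₁ α₂ α₃ : ℝ) (hα₁ : 0 < α₁) (hα₂ : 0 < α₂) (hα₃ : 0 < α₃)
    (hsandwich : ∀ s, α₁ * c s ≤ L s ∧ L s ≤ α₂ * c s)
    (hLρ : Integrable L ρ)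
    (henergy :
      (∫ s, ((∫ s', L s' ∂(P s)) - L s) ∂(ν.withDensity q))
        ≤ -α₃ * ∫ s, c s ∂(ν.withDensity q)) :
    Tendsto (fun t => ∫ s, c s ∂(μ t)) atTop (nhds 0) := by
  have hb : ∀ᵐ s ∂ν, ∀ t, p t s ≤ (M : ℝ≥0∞) := ae_all_iff.2 hbound
  have hqM : ∀ᵐ s ∂ν, q s ≤ (M : ℝ≥0∞) := by
    filter_upwards [hb, hconv] with s h1 h2
    exact le_of_tendsto' h2 h1
  have hqfin : ∀ᵐ s ∂ν, q s < ∞ := hqM.mono fun s h => h.trans_lt ENNReal.coe_lt_top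
  have hpfin : ∀ t, ∀ᵐ s ∂ν, p t s < ∞ :=
    fun t => (hbound t).mono fun s h => h.trans_lt ENNReal.coe_lt_top
  have hprob : ∀ t, IsProbabilityMeasure (μ t) := by
    intro t
    induction t with
    | zero => rw [hμ0]; infer_instance
    | succ t ih => rw [hμ]; infer_instance
  -- integrability of `c`, `L` against the limit
  have hcq : Integrable c (ν.withDensity q) := by
    have h1 : Integrable c ((M : ℝ≥0∞) • ν) := hcint.smul_measure ENNReal.coe_ne_top
    refine h1.mono_measure ?_
    rw [← withDensity_const]
    exact withDensity_mono hqM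
  have hLq : Integrable L (ν.withDensity q) := by
    refine (hcq.const_mul α₂).mono' hLmeas.aestronglyMeasurable (ae_of_all _ fun s => ?_)
    rw [Real.norm_of_nonneg (hLnonneg s)]
    exact (hsandwich s).2
  -- invariance of the limit
  have hinv : (ν.withDensity q).bind P = ν.withDensity q := by
    have hle : (ν.withDensity q).bind P ≤ ν.withDensity q := by
      refine Measure.le_iff.2 fun A hA => ?_
      have hPA : Measurable fun s => P s A := P.measurable_coe hA
      have hind : Measurable (Aᶜ.indicator (1 : S → ℝ≥0∞)) :=
        measurable_one.indicator hA.compl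
      have hF := lintegral_liminf_le (μ := ν) (u := atTop)
        (f := fun t s => p t s * P s A + p (t + 1) s * Aᶜ.indicator (1 : S → ℝ≥0∞) s)
        (fun t => ((hpmeas t).mul hPA).add ((hpmeas (t + 1)).mul hind))
      have hR : ∀ t, ∫⁻ s, (p t s * P s A + p (t + 1) s * Aᶜ.indicator (1 : S → ℝ≥0∞) s) ∂ν
          = 1 := by
        intro t
        rw [lintegral_add_left (f := fun s => p t s * P s A) ((hpmeas t).mul hPA)]
        have e1 : ∫⁻ s, p t s * P s A ∂ν = μ (t + 1) A := by
          rw [hμ t, Measure.bind_apply hA P.aemeasurable, hdens t,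
            lintegral_withDensity_eq_lintegral_mul _ (hpmeas t) hPA]
          rfl
        have e2 : ∫⁻ s, p (t + 1) s * Aᶜ.indicator (1 : S → ℝ≥0∞) s ∂ν = μ (t + 1) Aᶜ := by
          rw [← lintegral_indicator_one hA.compl, hdens (t + 1),
            lintegral_withDensity_eq_lintegral_mul _ (hpmeas (t + 1)) hind]
          rfl
        rw [e1, e2]
        haveI := hprob (t + 1)
        exact prob_add_prob_compl hA
      have hL : ∫⁻ s, liminf (fun t => p t s * P s A
          + p (t + 1) s * Aᶜ.indicator (1 : S → ℝ≥0∞) s) atTop ∂ν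
          = (ν.withDensity q).bind P A + (ν.withDensity q) Aᶜ := by
        have e1 : (ν.withDensity q).bind P A = ∫⁻ s, q s * P s A ∂ν := by
          rw [Measure.bind_apply hA P.aemeasurable,
            lintegral_withDensity_eq_lintegral_mul _ hqmeas hPA]
          rfl
        have e2 : (ν.withDensity q) Aᶜ = ∫⁻ s, q s * Aᶜ.indicator (1 : S → ℝ≥0∞) s ∂ν := by
          rw [← lintegral_indicator_one hA.compl,
            lintegral_withDensity_eq_lintegral_mul _ hqmeas hind]
          rfl
        rw [e1, e2, ← lintegral_add_left (f := fun s => q s * P s A) (hqmeas.mul hPA)]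
        refine lintegral_congr_ae ?_
        filter_upwards [hconv] with s hs
        refine Tendsto.liminf_eq ?_
        refine Tendsto.add (ENNReal.Tendsto.mul_const hs (Or.inr (measure_ne_top _ _)))
          (ENNReal.Tendsto.mul_const (hs.comp (tendsto_add_atTop_nat 1)) (Or.inr ?_))
        by_cases h : s ∈ Aᶜ <;> simp [Set.indicator, h]
      simp only [hR] at hF
      rw [hL, liminf_const, ← prob_add_prob_compl (μ := ν.withDensity q) hA] at hF
      exact (ENNReal.add_le_add_iff_right (measure_ne_top _ _)).1 hF
    exact Measure.eq_of_le_of_isProbabilityMeasure hle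
  obtain ⟨hPLint, hPL⟩ := stab_aux P (ν.withDensity q) L (by rw [hinv]; exact hLq)
  rw [hinv] at hPL
  rw [integral_sub hPLint hLq, hPL, sub_self] at henergy
  have hc0 : ∫ s, c s ∂(ν.withDensity q) = 0 := by
    have h0 : 0 ≤ ∫ s, c s ∂(ν.withDensity q) := integral_nonneg hcnonneg
    nlinarith
  rw [← hc0, integral_withDensity_eq_integral_toReal_smul hqmeas hqfin]
  have : ∀ t, ∫ s, c s ∂(μ t) = ∫ s, (p t s).toReal • c s ∂ν := fun t => by
    rw [hdens t, integral_withDensity_eq_integral_toReal_smul (hpmeas t) (hpfin t)]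
  simp only [this]
  refine tendsto_integral_of_dominated_convergence (fun s => (M : ℝ) * c s)
    (fun t => ((hpmeas t).ennreal_toReal.smul hcmeas).aestronglyMeasurable)
    (hcint.const_mul _) (fun t => ?_) ?_
  · filter_upwards [hbound t] with s hs
    rw [smul_eq_mul, Real.norm_of_nonneg (mul_nonneg ENNReal.toReal_nonneg (hcnonneg s))]
    refine mul_le_mul_of_nonneg_right ?_ (hcnonneg s)
    exact ENNReal.toReal_mono ENNReal.coe_ne_top hs
  · filter_upwards [hconv, hqfin] with s hs hf
    exact ((ENNReal.tendsto_toReal hf.ne).comp hs).smul_const _
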